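/- arXiv:1202.3528 — 4 statements merged into one kernel-verified Lean document; each statement's English description precedes it below -/
import Mathlib

section
/- Let N ≥ 1 and let f : ℝ^N → ℝ be continuous. Suppose {y¹, …, y^N} is a basis of ℝ^N and a₁, …, a_N are real numbers such that f(x + y^j) = f(x) + a_j for every x ∈ ℝ^N and every j = 1, …, N. Then for every y ∈ ℝ^N the function x ↦ f(x + y) − f(x) attains both a maximum and a minimum on ℝ^N. -/
open Metric Real Set

/-- A function invariant under translation by each vector of a family is invariant under
translation by the lattice they span. -/
lemma periodic_of_mem_span_int {E ι α : Type*} [AddCommGroup E] {y : ι → E} {g : E → α}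
    (hg : ∀ i, Function.Periodic g (y i)) {z : E} (hz : z ∈ Submodule.span ℤ (Set.range y)) :
    Function.Periodic g z := by
  induction hz using Submodule.span_induction with
  | mem z hz => obtain ⟨i, rfl⟩ := hz; exact hg i
  | zero => exact fun x => by rw [add_zero]
  | add z w _ _ hz hw => exact hz.add_period hw
  | smul n z _ hz => exact hz.zsmul n

/-- A continuous function periodic along a basis of a finite-dimensional space has compact
range. -/
lemma isCompact_range_of_periodic_basis {E ι α : Type*} [NormedAddCommGroup E] [NormedSpace ℝ E]
    [Finite ι] [TopologicalSpace α] (b : Module.Basis ι ℝ E) {g : E → α} (hg : Continuous g)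
    (hper : ∀ i, Function.Periodic g (b i)) : IsCompact (Set.range g) := by
  have := Fintype.ofFinite ι
  have := b.finiteDimensional_of_finite
  have := FiniteDimensional.proper ℝ E
  have hK : IsCompact (closure (ZSpan.fundamentalDomain b)) :=
    (ZSpan.fundamentalDomain_isBounded b).isCompact_closure
  convert hK.image hg
  refine (Set.range_subset_iff.2 fun x => ?_).antisymm (Set.image_subset_range _ _)
  refine ⟨ZSpan.fract b x, subset_closure (ZSpan.fract_mem_fundamentalDomain b x), ?_⟩
  rw [ZSpan.fract_apply]
  exact (periodic_of_mem_span_int hper (ZSpan.floor b x).2).sub_eq x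

/-- If `f(x + yʲ) = f(x) + aⱼ` for a basis `y¹, …, y^N` of `ℝ^N`, then for
every `y` the function `x ↦ f(x + y) − f(x)` attains both a maximum and a minimum on `ℝ^N`. -/
theorem increments_attain_max_and_min_of_periodicity
    {N : ℕ} (hN : 1 ≤ N)
    (f : EuclideanSpace ℝ (Fin N) → ℝ) (hf : Continuous f)
    (y : Fin N → EuclideanSpace ℝ (Fin N))
    (hyind : LinearIndependent ℝ y) (hyspan : Submodule.span ℝ (Set.range y) = ⊤)
    (a : Fin N → ℝ)
    (hper : ∀ (x : EuclideanSpace ℝ (Fin N)) (j : Fin N), f (x + y j) = f x + a j) :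
    ∀ v : EuclideanSpace ℝ (Fin N),
      (∃ x₀, ∀ x, f (x + v) - f x ≤ f (x₀ + v) - f x₀) ∧
      (∃ x₁, ∀ x, f (x₁ + v) - f x₁ ≤ f (x + v) - f x) := by
  intro v
  have hrange : IsCompact (Set.range fun x => f (x + v) - f x) := by
    refine isCompact_range_of_periodic_basis (Module.Basis.mk hyind hyspan.ge) (by fun_prop)
      fun j x => ?_
    rw [Module.Basis.mk_apply, add_right_comm, hper, hper]
    ring
  obtain ⟨_, ⟨x₀, rfl⟩, h₀⟩ := hrange.exists_isGreatest (Set.range_nonempty _)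
  obtain ⟨_, ⟨x₁, rfl⟩, h₁⟩ := hrange.exists_isLeast (Set.range_nonempty _)
  exact ⟨⟨x₀, fun x => h₀ ⟨x, rfl⟩⟩, ⟨x₁, fun x => h₁ ⟨x, rfl⟩⟩⟩
end

section
/- Let N ≥ 1, let f : ℝ^N → ℝ be continuous and let R > 0. Define g(x) := sup_{|x−y| ≤ R} { f(y) + √(R² − |x−y|²) }. Then: (a) g(x) ≥ f(x) + R for every x ∈ ℝ^N; and (b) if the set {|f(x) − f(y)| : x, y ∈ ℝ^N, |x − y| ≤ 1} is bounded, then g − f is bounded on ℝ^N and the set {|g(x) − g(y)| : x, y ∈ ℝ^N, |x − y| ≤ 1} is also bounded. -/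
open Metric Real Set

/-- A function with bounded oscillation over distance `1` has oscillation growing at most linearly
in the distance. -/
theorem abs_sub_le_nat_mul_of_dist_le {E : Type*} [NormedAddCommGroup E] [NormedSpace ℝ E]
    {f : E → ℝ} {C : ℝ} (hC : ∀ x y, dist x y ≤ 1 → |f x - f y| ≤ C) (n : ℕ) :
    ∀ x y, dist x y ≤ n → |f x - f y| ≤ n * C := by
  induction n with
  | zero =>
    intro x y h
    have hxy : x = y := dist_le_zero.mp (by simpa using h)
    simp [hxy]
  | succ n ih =>
    intro x y h
    push_cast at h ⊢
    have hn : (0 : ℝ) < n + 1 := by positivity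
    set z := AffineMap.lineMap (k := ℝ) x y (1 / ((n : ℝ) + 1)) with hz
    have hxz : dist x z ≤ 1 := by
      rw [hz, dist_left_lineMap, Real.norm_of_nonneg (by positivity), one_div,
        inv_mul_le_iff₀ hn]
      linarith
    have hzy : dist z y ≤ n := by
      have h1 : (1 : ℝ) - 1 / (n + 1) = n / (n + 1) := by
        field_simp
        ring
      rw [hz, dist_lineMap_right, h1, Real.norm_of_nonneg (by positivity), div_mul_eq_mul_div,
        div_le_iff₀ hn]
      exact mul_le_mul_of_nonneg_left h (Nat.cast_nonneg n)
    have := abs_sub_le (f x) (f z) (f y)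
    linarith [hC x z hxz, ih z y hzy]

/-- The values over which the sup-convolution of a continuous function takes its supremum are
bounded above. -/
theorem bddAbove_sup_convolution_values {E : Type*} [PseudoMetricSpace E] [ProperSpace E]
    {f : E → ℝ} (hf : Continuous f) (R : ℝ) (x : E) :
    BddAbove {v : ℝ | ∃ y, dist x y ≤ R ∧ v = f y + Real.sqrt (R ^ 2 - dist x y ^ 2)} := by
  have hcont : Continuous fun y => f y + Real.sqrt (R ^ 2 - dist x y ^ 2) := by fun_prop
  refine ((isCompact_closedBall x R).image hcont).bddAbove.mono ?_
  rintro v ⟨y, hy, rfl⟩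
  exact ⟨y, by rwa [Metric.mem_closedBall'], rfl⟩

/-- For the sup-convolution `g` of `f`: (a) `g ≥ f + R`; (b) if
`{|f(x) − f(y)| : |x − y| ≤ 1}` is bounded, then `g − f` is bounded and
`{|g(x) − g(y)| : |x − y| ≤ 1}` is bounded. -/
theorem sup_convolution_bounds
    {N : ℕ} (hN : 1 ≤ N)
    (f : EuclideanSpace ℝ (Fin N) → ℝ) (hf : Continuous f)
    (R : ℝ) (hR : 0 < R)
    (g : EuclideanSpace ℝ (Fin N) → ℝ)
    (hg : ∀ x, g x =
      sSup {v : ℝ | ∃ y, dist x y ≤ R ∧ v = f y + Real.sqrt (R ^ 2 - dist x y ^ 2)}) :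
    (∀ x, f x + R ≤ g x) ∧
    ((∃ C : ℝ, ∀ x y, dist x y ≤ 1 → |f x - f y| ≤ C) →
      (∃ C' : ℝ, ∀ x, |g x - f x| ≤ C') ∧
      (∃ C'' : ℝ, ∀ x y, dist x y ≤ 1 → |g x - g y| ≤ C'')) := by
  have lower : ∀ x, f x + R ≤ g x := by
    intro x
    rw [hg x]
    refine le_csSup (bddAbove_sup_convolution_values hf R x) ⟨x, by simpa using hR.le, ?_⟩
    simp [Real.sqrt_sq hR.le]
  refine ⟨lower, ?_⟩
  rintro ⟨C, hC⟩
  have upper : ∀ x, g x ≤ f x + (⌈R⌉₊ * C + R) := by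
    intro x
    rw [hg x]
    refine csSup_le ⟨_, x, by simpa using hR.le, rfl⟩ ?_
    rintro v ⟨y, hy, rfl⟩
    have hosc := abs_le.mp
      (abs_sub_le_nat_mul_of_dist_le hC ⌈R⌉₊ x y (hy.trans (Nat.le_ceil R)))
    have hsqrt : Real.sqrt (R ^ 2 - dist x y ^ 2) ≤ R :=
      Real.sqrt_le_iff.mpr ⟨hR.le, by linarith [sq_nonneg (dist x y)]⟩
    linarith [hosc.1]
  have bound : ∀ x, |g x - f x| ≤ ⌈R⌉₊ * C + R := by
    intro x
    rw [abs_le]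
    constructor <;> linarith [lower x, upper x]
  refine ⟨⟨_, bound⟩, 2 * (⌈R⌉₊ * C + R) + C, fun x y hxy => ?_⟩
  have hx := abs_le.mp (bound x)
  have hy := abs_le.mp (bound y)
  have hf' := abs_le.mp (hC x y hxy)
  rw [abs_le]
  constructor <;> linarith [hx.1, hx.2, hy.1, hy.2, hf'.1, hf'.2]
end

section
/- Let R > 0 and let a, b be real numbers with −2/R < a < 2/R and −2/R < b < 2/R. Suppose that a/(1 + Ra/2) + b/(1 + Rb/2) ≤ 0 ≤ a/(1 − Ra/2) + b/(1 − Rb/2). Then ab ≤ 0, Rab ≤ a + b ≤ −Rab, and a² + b² ≤ −6ab. -/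
/-- Elementary inequality used for the parallel surface `Γ*`: if
`−2/R < a, b < 2/R` and `a/(1 + Ra/2) + b/(1 + Rb/2) ≤ 0 ≤ a/(1 − Ra/2) + b/(1 − Rb/2)`,
then `ab ≤ 0`, `Rab ≤ a + b ≤ −Rab`, and `a² + b² ≤ −6ab`. -/
theorem principal_curvature_inequalities
    (R a b : ℝ) (hR : 0 < R)
    (ha₁ : -2 / R < a) (ha₂ : a < 2 / R) (hb₁ : -2 / R < b) (hb₂ : b < 2 / R)
    (hle : a / (1 + R * a / 2) + b / (1 + R * b / 2) ≤ 0)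
    (hge : 0 ≤ a / (1 - R * a / 2) + b / (1 - R * b / 2)) :
    a * b ≤ 0 ∧ R * (a * b) ≤ a + b ∧ a + b ≤ -(R * (a * b)) ∧
      a ^ 2 + b ^ 2 ≤ -(6 * (a * b)) := by
  rw [div_lt_iff₀ hR] at ha₁ hb₁
  rw [lt_div_iff₀ hR] at ha₂ hb₂
  have ha_add : 0 < 1 + R * a / 2 := by linarith
  have ha_sub : 0 < 1 - R * a / 2 := by linarith
  have hb_add : 0 < 1 + R * b / 2 := by linarith
  have hb_sub : 0 < 1 - R * b / 2 := by linarith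
  rw [div_add_div _ _ ha_add.ne' hb_add.ne', div_le_iff₀ (mul_pos ha_add hb_add)] at hle
  rw [div_add_div _ _ ha_sub.ne' hb_sub.ne', le_div_iff₀ (mul_pos ha_sub hb_sub)] at hge
  have hupper : a + b ≤ -(R * (a * b)) := by linarith
  have hlower : R * (a * b) ≤ a + b := by linarith
  have hab : a * b ≤ 0 := nonpos_of_mul_nonpos_right (by linarith) hR
  have hsq : (a + b) ^ 2 ≤ (R * (a * b)) ^ 2 :=
    sq_le_sq' (by linarith) (by linarith) |>.trans_eq (neg_sq _)
  have hprod : 0 ≤ 4 + R ^ 2 * (a * b) := by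
    linarith [mul_pos ha_add hb_add, mul_pos ha_sub hb_sub]
  refine ⟨hab, hlower, hupper, ?_⟩
  linarith [mul_nonpos_of_nonpos_of_nonneg hab hprod]
end

section
/- Let a, b ∈ ℝ and define f : ℝ → ℝ by f(x) = ax + b + sin x. Then: (i) for every y ∈ ℝ the function x ↦ f(x + y) − f(x) attains both a maximum and a minimum on ℝ; and (ii) if y/(2π) is not an integer, then there is no real number h such that f(x + y) − f(x) → h as |x| → ∞. -/
open Real

theorem affine_add_sin_increment (a b x y : ℝ) :
    (a * (x + y) + b + sin (x + y)) - (a * x + b + sin x) =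
      a * y + 2 * sin (y / 2) * cos (x + y / 2) := by
  have h := sin_sub_sin (x + y) x
  rw [show (x + y - x) / 2 = y / 2 by ring, show (x + y + x) / 2 = x + y / 2 by ring] at h
  linear_combination h

/-- For `f(x) = ax + b + sin x`: (i) for every `y` the function
`x ↦ f(x + y) − f(x)` attains both a maximum and a minimum on `ℝ`; (ii) if `y/(2π)` is not an
integer, then `f(x + y) − f(x)` has no limit `h` as `|x| → ∞`. -/
theorem sine_example_increments
    (a b : ℝ) (f : ℝ → ℝ) (hf : ∀ x, f x = a * x + b + Real.sin x) :
    (∀ y : ℝ,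
      (∃ x₀, ∀ x, f (x + y) - f x ≤ f (x₀ + y) - f x₀) ∧
      (∃ x₁, ∀ x, f (x₁ + y) - f x₁ ≤ f (x + y) - f x)) ∧
    (∀ y : ℝ, (∀ k : ℤ, y / (2 * π) ≠ (k : ℝ)) →
      ¬ ∃ h : ℝ, ∀ ε > (0:ℝ), ∃ M : ℝ, ∀ x : ℝ, M ≤ |x| →
        |f (x + y) - f x - h| < ε) := by
  have hinc (x y : ℝ) : f (x + y) - f x = a * y + 2 * sin (y / 2) * cos (x + y / 2) := by
    rw [hf, hf, affine_add_sin_increment]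
  simp only [hinc]
  refine ⟨fun y => ?_, ?_⟩
  · have h₀ : cos (-(y / 2) + y / 2) = 1 := by simp
    have h₁ : cos (π - y / 2 + y / 2) = -1 := by simp
    rcases le_total 0 (sin (y / 2)) with hs | hs
    · refine ⟨⟨-(y / 2), fun x => ?_⟩, ⟨π - y / 2, fun x => ?_⟩⟩
      · rw [h₀]; nlinarith [cos_le_one (x + y / 2)]
      · rw [h₁]; nlinarith [neg_one_le_cos (x + y / 2)]
    · refine ⟨⟨π - y / 2, fun x => ?_⟩, ⟨-(y / 2), fun x => ?_⟩⟩
      · rw [h₁]; nlinarith [neg_one_le_cos (x + y / 2)]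
      · rw [h₀]; nlinarith [cos_le_one (x + y / 2)]
  · rintro y hy ⟨h, hlim⟩
    have hs : sin (y / 2) ≠ 0 := by
      rw [Ne, sin_eq_zero_iff]
      rintro ⟨k, hk⟩
      refine hy k ?_
      rw [div_eq_iff (by positivity)]
      linear_combination -2 * hk
    obtain ⟨M, hM⟩ := hlim |sin (y / 2)| (abs_pos.mpr hs)
    obtain ⟨n, hn⟩ := exists_nat_gt ((M + y / 2) / (2 * π))
    rw [div_lt_iff₀ (by positivity)] at hn
    have hmax := hM (n * (2 * π) - y / 2) ((by linarith : M ≤ _).trans (le_abs_self _))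
    have hmin := hM (n * (2 * π) + π - y / 2)
      ((by linarith [pi_pos] : M ≤ _).trans (le_abs_self _))
    rw [sub_add_cancel, cos_nat_mul_two_pi] at hmax
    rw [sub_add_cancel, cos_nat_mul_two_pi_add_pi] at hmin
    rw [abs_lt] at hmax hmin
    rcases abs_cases (sin (y / 2)) with ⟨h', _⟩ | ⟨h', _⟩ <;> rw [h'] at hmax hmin <;> linarith
end
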